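/- Let A = [[a,b],[c,d]] ∈ SL(2,ℤ) be hyperbolic, i.e. |a+d| > 2. Then the set of points v ∈ ℚ ∪ {∞} such that v and A·v are Farey-adjacent is contained in the union of at most two A-equivalence classes (at most two orbits of the cyclic group generated by A). -/

import Mathlib

open OnePoint Matrix

/-- `SL(2,ℤ)`. -/
abbrev SL2Z := Matrix.SpecialLinearGroup (Fin 2) ℤ

/-- The Möbius action of `SL(2,ℤ)` on the rational projective line `ℚ ∪ {∞}`:
the matrix `[[a,b],[c,d]]` sends `x` to `(ax+b)/(cx+d)` (and `∞ = 1/0`). -/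
def mob (A : SL2Z) : OnePoint ℚ → OnePoint ℚ
  | OnePoint.infty =>
      if (A.1 1 0 : ℚ) = 0 then OnePoint.infty
      else OnePoint.some ((A.1 0 0 : ℚ) / (A.1 1 0 : ℚ))
  | OnePoint.some x =>
      if (A.1 1 0 : ℚ) * x + (A.1 1 1 : ℚ) = 0 then OnePoint.infty
      else OnePoint.some (((A.1 0 0 : ℚ) * x + (A.1 0 1 : ℚ)) /
        ((A.1 1 0 : ℚ) * x + (A.1 1 1 : ℚ)))

/-- Farey adjacency on `ℚ ∪ {∞}`: the reduced fractions `p/q` and `r/s`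
are adjacent iff `|ps - qr| = 1`, where `∞ = 1/0`.  (Rationals in Lean are
stored in lowest terms with positive denominator.) -/
def fareyAdj : OnePoint ℚ → OnePoint ℚ → Prop
  | OnePoint.infty, OnePoint.infty => False
  | OnePoint.infty, OnePoint.some x => x.den = 1
  | OnePoint.some x, OnePoint.infty => x.den = 1
  | OnePoint.some x, OnePoint.some y => |x.num * (y.den : ℤ) - (x.den : ℤ) * y.num| = 1


def toPt (p q : ℤ) : OnePoint ℚ :=
  if q = 0 then OnePoint.infty else OnePoint.some ((p : ℚ) / (q : ℚ))

lemma toPt_neg (p q : ℤ) : toPt (-p) (-q) = toPt p q := by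
  unfold toPt
  by_cases h : q = 0 <;> simp [h, neg_div_neg_eq]

lemma exists_toPt (v : OnePoint ℚ) : ∃ p q : ℤ, IsCoprime p q ∧ toPt p q = v := by
  induction v using OnePoint.rec with
  | infty => exact ⟨1, 0, isCoprime_one_left, by simp [toPt]⟩
  | coe x =>
    refine ⟨x.num, x.den, ?_, ?_⟩
    · rw [Int.isCoprime_iff_gcd_eq_one]
      simpa [Int.gcd] using x.reduced
    · have : (x.den : ℤ) ≠ 0 := by simp
      simp only [toPt, this, if_false]
      have := Rat.num_div_den x
      push_cast
      rw [this]

lemma mob_toPt (B : SL2Z) (p q : ℤ) (h : p ≠ 0 ∨ q ≠ 0) :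
    mob B (toPt p q) = toPt (B.1 0 0 * p + B.1 0 1 * q) (B.1 1 0 * p + B.1 1 1 * q) := by
  unfold toPt
  by_cases hq : q = 0
  · have hp : p ≠ 0 := by tauto
    have hp' : (p : ℚ) ≠ 0 := by exact_mod_cast hp
    by_cases hc : B.1 1 0 = 0
    · simp [hq, mob, hc]
    · simp [hq, mob, hc, hp]
      rw [mul_div_mul_right _ _ hp']
  · have hq' : (q : ℚ) ≠ 0 := by exact_mod_cast hq
    have key : (B.1 1 0 : ℚ) * ((p : ℚ) / q) + (B.1 1 1 : ℚ)
        = ((B.1 1 0 * p + B.1 1 1 * q : ℤ) : ℚ) / q := by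
      push_cast; field_simp
    have key2 : (B.1 0 0 : ℚ) * ((p : ℚ) / q) + (B.1 0 1 : ℚ)
        = ((B.1 0 0 * p + B.1 0 1 * q : ℤ) : ℚ) / q := by
      push_cast; field_simp
    simp only [hq, if_false, mob]
    rw [key, key2]
    by_cases hc : B.1 1 0 * p + B.1 1 1 * q = 0
    · rw [hc]; simp
    · have hc' : ((B.1 1 0 * p + B.1 1 1 * q : ℤ) : ℚ) ≠ 0 := by exact_mod_cast hc
      rw [if_neg hc, if_neg (div_ne_zero hc' hq')]
      congr 1
      field_simp

lemma mul_nonzero (B : SL2Z) (p q : ℤ) (h : p ≠ 0 ∨ q ≠ 0) :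
    (B.1 0 0 * p + B.1 0 1 * q) ≠ 0 ∨ (B.1 1 0 * p + B.1 1 1 * q) ≠ 0 := by
  by_contra hc
  push Not at hc
  obtain ⟨h1, h2⟩ := hc
  have hd : B.1 0 0 * B.1 1 1 - B.1 0 1 * B.1 1 0 = 1 := by
    rw [← Matrix.det_fin_two]; exact B.2
  have hp : p = 0 := by linear_combination (-p) * hd + B.1 1 1 * h1 - B.1 0 1 * h2
  have hq : q = 0 := by linear_combination (-q) * hd - B.1 1 0 * h1 + B.1 0 0 * h2
  tauto

lemma coprime_nonzero {p q : ℤ} (h : IsCoprime p q) : p ≠ 0 ∨ q ≠ 0 := by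
  by_contra hc
  push Not at hc
  obtain ⟨rfl, rfl⟩ := hc
  exact not_isCoprime_zero_zero h

lemma mob_mul (B C : SL2Z) (v : OnePoint ℚ) : mob (B * C) v = mob B (mob C v) := by
  obtain ⟨p, q, hpq, rfl⟩ := exists_toPt v
  have h := coprime_nonzero hpq
  rw [mob_toPt _ _ _ h, mob_toPt _ _ _ h, mob_toPt _ _ _ (mul_nonzero C p q h)]
  have e : (B * C).1 = B.1 * C.1 := rfl
  rw [e]
  simp only [Matrix.mul_apply, Fin.sum_univ_two]
  congr 1 <;> ring

lemma mob_one (v : OnePoint ℚ) : mob 1 v = v := by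
  obtain ⟨p, q, hpq, rfl⟩ := exists_toPt v
  rw [mob_toPt _ _ _ (coprime_nonzero hpq)]
  simp

lemma orb_iff (A : SL2Z) (v w : OnePoint ℚ) :
    (∃ n : ℤ, mob (A ^ n) v = mob A w) ↔ ∃ n : ℤ, mob (A ^ n) v = w := by
  constructor
  · rintro ⟨n, hn⟩
    refine ⟨-1 + n, ?_⟩
    rw [_root_.zpow_add, mob_mul, hn, ← mob_mul]
    simp [mob_one]
  · rintro ⟨n, hn⟩
    refine ⟨1 + n, ?_⟩
    rw [_root_.zpow_add, mob_mul, hn]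
    simp

lemma toPt_coprime {p q : ℤ} (h : IsCoprime p q) (hq : q ≠ 0) :
    ∃ e : ℤ, |e| = 1 ∧ p = e * ((p : ℚ) / q).num ∧ q = e * (((p : ℚ) / q).den : ℤ) := by
  rw [Int.isCoprime_iff_gcd_eq_one] at h
  rcases lt_or_gt_of_ne hq with hn | hp
  · refine ⟨-1, by simp, ?_, ?_⟩
    · have := Rat.num_div_eq_of_coprime (a := -p) (b := -q) (by omega) (by simpa [Int.gcd] using h)
      push_cast at this
      rw [neg_div_neg_eq] at this
      rw [this]; ring
    · have := Rat.den_div_eq_of_coprime (a := -p) (b := -q) (by omega) (by simpa [Int.gcd] using h)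
      push_cast at this
      rw [neg_div_neg_eq] at this
      rw [this]; ring
  · refine ⟨1, by simp, ?_, ?_⟩
    · rw [Rat.num_div_eq_of_coprime hp (by simpa [Int.gcd] using h)]; ring
    · rw [Rat.den_div_eq_of_coprime hp (by simpa [Int.gcd] using h)]; ring

lemma abs_of_coprime_zero {p : ℤ} (h : IsCoprime p 0) : |p| = 1 := by
  rw [isCoprime_zero_right] at h
  exact Int.isUnit_iff_abs_eq.mp h

lemma farey_toPt {p q r s : ℤ} (h : IsCoprime p q) (h' : IsCoprime r s)
    (H : fareyAdj (toPt p q) (toPt r s)) : |p * s - q * r| = 1 := by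
  by_cases hq : q = 0
  · subst hq
    have hp := abs_of_coprime_zero h
    by_cases hs : s = 0
    · subst hs
      simp [toPt, fareyAdj] at H
    · obtain ⟨e, he, -, h2⟩ := toPt_coprime h' hs
      simp only [toPt, hs, if_false, if_true, fareyAdj] at H
      rw [H] at h2
      simp [abs_mul, hp, h2, he]
  · obtain ⟨e, he, h1, h2⟩ := toPt_coprime h hq
    by_cases hs : s = 0
    · subst hs
      have hr := abs_of_coprime_zero h'
      simp only [toPt, hq, if_false, if_true, fareyAdj] at H
      rw [H] at h2
      simp [abs_mul, hr, h2, he]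
    · obtain ⟨f, hf, h3, h4⟩ := toPt_coprime h' hs
      simp only [toPt, hq, hs, if_false, fareyAdj] at H
      generalize ((p : ℚ) / q).num = a at *
      generalize (((p : ℚ) / q).den : ℤ) = b at *
      generalize ((r : ℚ) / s).num = c at *
      generalize (((r : ℚ) / s).den : ℤ) = d at *
      have : p * s - q * r = e * f * (a * d - b * c) := by
        rw [h1, h2, h3, h4]; ring
      rw [this, abs_mul, abs_mul, he, hf, H]; rfl

lemma descent_bound {t X Y : ℤ} (hX : 0 < X) (hXY : X < Y)
    (h : |X ^ 2 - t * X * Y + Y ^ 2| = 1) : |t * X - Y| < Y := by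
  have h1 := abs_le.mp h.le
  rw [abs_lt]
  constructor <;> by_contra hc <;> push Not at hc
  · nlinarith
  · nlinarith

lemma descent_pos (t : ℤ) (ht : 3 ≤ t) (P : ℤ → ℤ → Prop) (h0 : P 1 0) (h1 : P 1 (-1))
    (neg : ∀ x y, P x y → P (-x) (-y)) (fwd : ∀ x y, P (-y) (x + t * y) ↔ P x y) :
    ∀ (N : ℕ) (x y : ℤ), x.natAbs + y.natAbs ≤ N → |x ^ 2 + t * x * y + y ^ 2| = 1 → P x y := by
  have h01 : P 0 1 := by
    have := (fwd 0 1).not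
    have := (fwd 1 0).2 h0
    simpa using this
  intro N
  induction N with
  | zero =>
    intro x y hN h
    have hx : x = 0 := by omega
    have hy : y = 0 := by omega
    subst hx hy
    simp at h
  | succ N ih =>
    have main : ∀ x Y : ℤ, 0 < x → 0 < Y → x.natAbs + Y.natAbs ≤ N + 1 →
        |x ^ 2 - t * x * Y + Y ^ 2| = 1 → P x (-Y) := by
      intro x Y hx hY hN h
      rcases lt_trichotomy x Y with hl | he | hl
      · have hb := descent_bound hx hl h
        have hb' := abs_lt.mp hb
        have := ih (t * x - Y) (-x) (by omega) (by rw [← h]; congr 1; ring)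
        rw [← fwd] at this
        have := (fwd x (-Y)).1 ?_
        · exact this
        · have e := (fwd (t * x - Y) (-x)).1 this
          have e2 : P (-(-x)) (t * x - Y + t * -x) := (fwd _ _).2 e
          rw [fwd]
          convert e2 using 1 <;> ring
      · subst he
        have : |x ^ 2 * (2 - t)| = 1 := by rw [← h]; congr 1; ring
        rw [abs_mul] at this
        have hx1 : |x ^ 2| = 1 := Int.eq_one_of_mul_eq_one_right (abs_nonneg _) this
        have : x = 1 := by
          rw [abs_of_nonneg (sq_nonneg x)] at hx1
          nlinarith
        rw [this]; exact h1
      · have h' : |Y ^ 2 - t * Y * x + x ^ 2| = 1 := by rw [← h]; congr 1; ring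
        have hb := descent_bound hY hl h'
        have hb' := abs_lt.mp hb
        have := ih Y (x - t * Y) (by omega) (by rw [← h]; congr 1; ring)
        rw [← fwd]
        convert this using 1 <;> ring
    intro x y hN h
    rcases lt_trichotomy x 0 with hx | hx | hx <;> rcases lt_trichotomy y 0 with hy | hy | hy
    · exfalso
      have := (abs_le.mp h.le).2
      have : 0 < x * y := by nlinarith
      nlinarith
    · subst hy
      have : x = -1 := by
        have := (abs_le.mp h.le).2
        nlinarith
      subst this
      simpa using neg _ _ h0
    · have := neg _ _ (main (-x) y (by omega) hy (by omega) (by rw [← h]; congr 1; ring))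
      simpa using this
    · subst hx
      have : y = -1 := by
        have := (abs_le.mp h.le).2
        nlinarith
      subst this
      simpa using neg _ _ h01
    · subst hx hy; simp at h
    · subst hx
      have : y = 1 := by
        have := (abs_le.mp h.le).2
        nlinarith
      subst this
      exact h01
    · have := main x (-y) hx (by omega) (by omega) (by rw [← h]; congr 1; ring)
      simpa using this
    · subst hy
      have : x = 1 := by
        have := (abs_le.mp h.le).2
        nlinarith
      subst this
      exact h0
    · exfalso
      have := (abs_le.mp h.le).2
      have : 0 < x * y := by nlinarith
      nlinarith

lemma descent (t : ℤ) (ht : 2 < |t|) (P : ℤ → ℤ → Prop) (h0 : P 1 0) (h1 : P 1 (-t.sign))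
    (neg : ∀ x y, P x y → P (-x) (-y)) (fwd : ∀ x y, P (-y) (x + t * y) ↔ P x y)
    (x y : ℤ) (h : |x ^ 2 + t * x * y + y ^ 2| = 1) : P x y := by
  rcases lt_abs.mp ht with hp | hn
  · rw [Int.sign_eq_one_of_pos (by omega)] at h1
    exact descent_pos t (by omega) P h0 h1 neg fwd _ x y le_rfl h
  · rw [Int.sign_eq_neg_one_of_neg (by omega)] at h1
    have := descent_pos (-t) (by omega) (fun x y => P x (-y)) (by simpa using h0)
      (by simpa using h1) (fun x y h => neg _ _ h) (fun x y => by
        show P (-y) (-(x + -t * y)) ↔ P x (-y)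
        rw [← fwd x (-y)]
        constructor
        · intro h
          have := neg _ _ h
          convert this using 1; ring
        · intro h
          have := neg _ _ h
          simp only [neg_neg] at this
          convert this using 1; ring) _ x (-y) le_rfl (by rw [← h]; congr 1; ring)
    simpa using this

lemma coprime_mul (A : SL2Z) {p q : ℤ} (h : IsCoprime p q) :
    IsCoprime (A.1 0 0 * p + A.1 0 1 * q) (A.1 1 0 * p + A.1 1 1 * q) := by
  have hd : A.1 0 0 * A.1 1 1 - A.1 0 1 * A.1 1 0 = 1 := by
    rw [← Matrix.det_fin_two]; exact A.2
  obtain ⟨a, b, hab⟩ := h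
  refine ⟨a * A.1 1 1 - b * A.1 1 0, -a * A.1 0 1 + b * A.1 0 0, ?_⟩
  linear_combination (a * p + b * q) * hd + hab

lemma farey_form (A : SL2Z) {p q : ℤ} (h : IsCoprime p q)
    (H : fareyAdj (toPt p q) (mob A (toPt p q))) :
    |p * (A.1 1 0 * p + A.1 1 1 * q) - q * (A.1 0 0 * p + A.1 0 1 * q)| = 1 := by
  rw [mob_toPt _ _ _ (coprime_nonzero h)] at H
  exact farey_toPt h (coprime_mul A h) H

theorem hyperbolic_at_most_two_classes (A : SL2Z)
    (hyp : |A.1 0 0 + A.1 1 1| > 2) :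
    ∃ v₁ v₂ : OnePoint ℚ, ∀ v : OnePoint ℚ,
      fareyAdj v (mob A v) →
      ((∃ n : ℤ, mob (A ^ n) v₁ = v) ∨ (∃ n : ℤ, mob (A ^ n) v₂ = v)) := by

  have hd : A.1 0 0 * A.1 1 1 - A.1 0 1 * A.1 1 0 = 1 := by
    rw [← Matrix.det_fin_two]; exact A.2
  by_cases hex : ∃ v, fareyAdj v (mob A v)
  swap
  · push Not at hex
    exact ⟨OnePoint.infty, OnePoint.infty, fun v hv => absurd hv (hex v)⟩
  obtain ⟨v, hv⟩ := hex
  obtain ⟨p, q, hpq, rfl⟩ := exists_toPt v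
  have hQ := farey_form A hpq hv
  have horb := orb_iff A
  have hmob := mob_toPt A
  have hform := fun (r s : ℤ) (h : IsCoprime r s) => farey_form A h
  generalize hT : A.1 0 0 + A.1 1 1 = t at hyp
  generalize A.1 0 0 = a at *
  generalize A.1 0 1 = b at *
  generalize A.1 1 0 = c at *
  generalize A.1 1 1 = d at *
  obtain ⟨p', hp'⟩ : ∃ p', p' = a * p + b * q := ⟨_, rfl⟩
  obtain ⟨q', hq'⟩ : ∃ q', q' = c * p + d * q := ⟨_, rfl⟩
  rw [← hp', ← hq'] at hQ
  have hAp : a * p' + b * q' = t * p' - p := by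
    rw [hp', hq', ← hT]; linear_combination (-p) * hd
  have hAq : c * p' + d * q' = t * q' - q := by
    rw [hp', hq', ← hT]; linear_combination (-q) * hd
  obtain ⟨e, he⟩ : ∃ e, e = p * q' - q * p' := ⟨_, rfl⟩
  rw [← he] at hQ
  have hee : e * e = 1 := by
    rw [← abs_mul_abs_self, hQ]; rfl
  let v₂ : OnePoint ℚ := toPt (p + (-t.sign) * p') (q + (-t.sign) * q')
  refine ⟨toPt p q, v₂, ?_⟩
  let P : ℤ → ℤ → Prop := fun x y =>
    (∃ n : ℤ, mob (A ^ n) (toPt p q) = toPt (x * p + y * p') (x * q + y * q')) ∨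
    (∃ n : ℤ, mob (A ^ n) v₂ = toPt (x * p + y * p') (x * q + y * q'))
  have hP : ∀ x y : ℤ, |x ^ 2 + t * x * y + y ^ 2| = 1 → P x y := by
    refine descent t hyp P ?_ ?_ ?_ ?_
    · left; exact ⟨0, by simp [mob_one]⟩
    · right; exact ⟨0, by simp [mob_one, v₂]⟩
    · intro x y h
      have e : toPt (-x * p + -y * p') (-x * q + -y * q')
          = toPt (x * p + y * p') (x * q + y * q') := by
        rw [← toPt_neg]; congr 1 <;> ring
      simpa only [P, e] using h
    · intro x y
      by_cases hz : x * p + y * p' ≠ 0 ∨ x * q + y * q' ≠ 0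
      · have := hmob _ _ hz
        have e : toPt (-y * p + (x + t * y) * p') (-y * q + (x + t * y) * q')
            = mob A (toPt (x * p + y * p') (x * q + y * q')) := by
          rw [this]
          congr 1
          · linear_combination x * hp' - y * hAp
          · linear_combination x * hq' - y * hAq
        simp only [P, e, horb]
      · push Not at hz
        obtain ⟨z1, z2⟩ := hz
        have hx : x = 0 := by
          linear_combination (-x) * hee + e * x * he + e * q' * z1 - e * p' * z2
        have hy : y = 0 := by
          linear_combination (-y) * hee + e * y * he - e * q * z1 + e * p * z2
        subst hx hy
        simp
  intro w hw
  obtain ⟨r, s, hrs, rfl⟩ := exists_toPt w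
  have hR := hform r s hrs hw
  have hr : r = (e * (r * q' - s * p')) * p + (e * (p * s - q * r)) * p' := by
    linear_combination (-r) * hee + e * r * he
  have hs : s = (e * (r * q' - s * p')) * q + (e * (p * s - q * r)) * q' := by
    linear_combination (-s) * hee + e * s * he
  generalize e * (r * q' - s * p') = x at hr hs
  generalize e * (p * s - q * r) = y at hr hs
  have := hP x y ?_
  · simp only [P, ← hr, ← hs] at this
    exact this
  · have e1 : r * (c * r + d * s) - s * (a * r + b * s) = e * (x ^ 2 + t * x * y + y ^ 2) := by
      have i1 : a * r + b * s = x * p' + y * (t * p' - p) := by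
        rw [hr, hs]; linear_combination (-x) * hp' + y * hAp
      have i2 : c * r + d * s = x * q' + y * (t * q' - q) := by
        rw [hr, hs]; linear_combination (-x) * hq' + y * hAq
      rw [i1, i2, he, hr, hs]; ring
    rw [e1, abs_mul, hQ, one_mul] at hR
    exact hR
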